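/- arXiv:math/0502493 — 2 statements merged into one kernel-verified Lean document; each statement's English description precedes it below -/
import Mathlib

section
/- For every complex number s with Re(s) > 0 and all nonzero real numbers a and b, the function v ↦ (a²·eᵛ + b²·e^{−v})^{−s} is integrable on ℝ, and ∫_ℝ (a²·eᵛ + b²·e^{−v})^{−s} dv = |ab|^{−s} · ∫_ℝ (eᵛ + e^{−v})^{−s} dv. -/
open MeasureTheory

/-- For `Re s > 0`, the function `v ↦ (eᵛ + e^{−v})^{−s}` is integrable on `ℝ`. -/
theorem integrable_exp_add_exp_neg_cpow_neg {s : ℂ} (hs : 0 < s.re) :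
    Integrable (fun v : ℝ => ((Real.exp v + Real.exp (-v) : ℝ) : ℂ) ^ (-s)) := by
  have hpos (v : ℝ) : 0 < Real.exp v + Real.exp (-v) := by positivity
  have hcont : Continuous
      (fun v : ℝ => ((Real.exp v + Real.exp (-v) : ℝ) : ℂ) ^ (-s)) := by
    refine Continuous.cpow (by fun_prop) continuous_const fun v => ?_
    exact Complex.ofReal_mem_slitPlane.2 (hpos v)
  have hbound (u v : ℝ) (huv : Real.exp u ≤ Real.exp v + Real.exp (-v)) :
      ‖((Real.exp v + Real.exp (-v) : ℝ) : ℂ) ^ (-s)‖ ≤ Real.exp (-s.re * u) := by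
    rw [Complex.norm_cpow_eq_rpow_re_of_pos (hpos v), Complex.neg_re, mul_comm, Real.exp_mul]
    exact Real.rpow_le_rpow_of_nonpos (Real.exp_pos u) huv (by linarith)
  rw [← integrableOn_univ, ← Set.Iic_union_Ioi (a := (0 : ℝ))]
  refine IntegrableOn.union ?_ ?_
  · refine Integrable.mono' (integrableOn_exp_mul_Iic hs 0) hcont.aestronglyMeasurable
      (.of_forall fun v => ?_)
    simpa using hbound (-v) v (by linarith [Real.exp_pos v])
  · refine Integrable.mono' (integrableOn_exp_mul_Ioi (neg_lt_zero.2 hs) 0)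
      hcont.aestronglyMeasurable (.of_forall fun v => ?_)
    exact hbound v v (by linarith [Real.exp_pos (-v)])

/-- Translating `v` by `log (|a| / |b|)` symmetrises `a²·eᵛ + b²·e^{−v}`. -/
theorem sq_mul_exp_add_sq_mul_exp_neg {a b : ℝ} (ha : a ≠ 0) (hb : b ≠ 0) (v : ℝ) :
    a ^ 2 * Real.exp v + b ^ 2 * Real.exp (-v) =
      |a * b| * (Real.exp (v + Real.log (|a| / |b|)) +
        Real.exp (-(v + Real.log (|a| / |b|)))) := by
  have ha' : 0 < |a| := abs_pos.2 ha
  have hb' : 0 < |b| := abs_pos.2 hb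
  rw [neg_add, Real.exp_add, Real.exp_add, Real.exp_neg (Real.log _),
    Real.exp_log (div_pos ha' hb'), abs_mul, ← sq_abs a, ← sq_abs b]
  field_simp

/-- Hecke's integral identity: for `Re s > 0` and nonzero reals `a`, `b`, the function
`v ↦ (a²·eᵛ + b²·e^{−v})^{−s}` is integrable on `ℝ` and
`∫ (a²·eᵛ + b²·e^{−v})^{−s} dv = |ab|^{−s} · ∫ (eᵛ + e^{−v})^{−s} dv`. -/
theorem hecke_integral_identity (s : ℂ) (hs : 0 < s.re) (a b : ℝ) (ha : a ≠ 0) (hb : b ≠ 0) :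
    Integrable (fun v : ℝ =>
      ((a ^ 2 * Real.exp v + b ^ 2 * Real.exp (-v) : ℝ) : ℂ) ^ (-s)) ∧
    (∫ v : ℝ, ((a ^ 2 * Real.exp v + b ^ 2 * Real.exp (-v) : ℝ) : ℂ) ^ (-s))
      = ((|a * b| : ℝ) : ℂ) ^ (-s) *
        ∫ v : ℝ, ((Real.exp v + Real.exp (-v) : ℝ) : ℂ) ^ (-s) := by
  have hfun : (fun v : ℝ => ((a ^ 2 * Real.exp v + b ^ 2 * Real.exp (-v) : ℝ) : ℂ) ^ (-s)) =
      fun v : ℝ => ((|a * b| : ℝ) : ℂ) ^ (-s) *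
        (fun w : ℝ => ((Real.exp w + Real.exp (-w) : ℝ) : ℂ) ^ (-s))
          (v + Real.log (|a| / |b|)) := by
    funext v
    rw [sq_mul_exp_add_sq_mul_exp_neg ha hb, Complex.ofReal_mul,
      Complex.mul_cpow_ofReal_nonneg (abs_nonneg _) (by positivity)]
  rw [hfun]
  refine ⟨((integrable_exp_add_exp_neg_cpow_neg hs).comp_add_right _).const_mul _, ?_⟩
  rw [integral_const_mul]
  exact congrArg _ (integral_add_right_eq_self
    (fun w : ℝ => ((Real.exp w + Real.exp (-w) : ℝ) : ℂ) ^ (-s)) _)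
end

section
/- Let F ⊆ L be number fields with F totally real of degree g over ℚ, L totally real, and [L : F] = 2. Then the subgroup H = { u ∈ (𝓞_L)ˣ : N_{L/F}(u) = 1 } of the unit group of the ring of integers of L is isomorphic as a group to {±1} × ℤ^g; in particular, H modulo {±1} is free abelian of rank g. -/
open NumberField

/-- A finitely generated abelian group splits as its torsion times a free part. -/
theorem Module.Finite.nonempty_equiv_torsion_prod_int (M : Type*) [AddCommGroup M]
    [Module.Finite ℤ M] :
    Nonempty (M ≃ₗ[ℤ] Submodule.torsion ℤ M × (Fin (Module.finrank ℤ M) → ℤ)) := by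
  have hr : Module.finrank ℤ (M ⧸ Submodule.torsion ℤ M) = Module.finrank ℤ M := by
    rw [Module.finrank, Module.finrank, rank_quotient_eq_of_le_torsion le_rfl]
  obtain ⟨l, hl⟩ := Module.projective_lifting_property (Submodule.torsion ℤ M).mkQ LinearMap.id
    (Submodule.mkQ_surjective _)
  have hex : Function.Exact (Submodule.torsion ℤ M).subtype (Submodule.torsion ℤ M).mkQ :=
    LinearMap.exact_subtype_mkQ _
  let e := (hex.splitSurjectiveEquiv (Submodule.subtype_injective _) ⟨l, hl⟩).1
  exact ⟨e.trans ((LinearEquiv.refl ℤ _).prodCongr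
    ((Module.finBasis ℤ (M ⧸ Submodule.torsion ℤ M)).equivFun.trans
      (LinearEquiv.funCongrLeft ℤ ℤ (finCongr hr.symm))))⟩

/-- A finitely generated abelian group whose torsion is `{1, c}` with `c ≠ 1` of square `1` is
isomorphic to `{±1} × ℤ^g`, where `g` is its rank. -/
theorem nonempty_mulEquiv_intUnits_prod_of_torsion {G : Type*} [CommGroup G]
    [Module.Finite ℤ (Additive G)] (c : G) (hc : c ≠ 1) (hc2 : c ^ 2 = 1)
    (htors : ∀ x : G, IsOfFinOrder x → x = 1 ∨ x = c) (g : ℕ)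
    (hg : Module.finrank ℤ (Additive G) = g) :
    Nonempty (G ≃* ℤˣ × Multiplicative (Fin g → ℤ)) := by
  subst hg
  obtain ⟨e⟩ := Module.Finite.nonempty_equiv_torsion_prod_int (Additive G)
  have hmem : Additive.ofMul c ∈ Submodule.torsion ℤ (Additive G) :=
    ⟨⟨2, by simp⟩, show (2 : ℤ) • Additive.ofMul c = 0 from by
      rw [← ofMul_zpow]; exact congrArg Additive.ofMul (by exact_mod_cast hc2)⟩
  have hcard : Nat.card (Submodule.torsion ℤ (Additive G)) = 2 := by
    rw [Nat.card_eq_two_iff]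
    refine ⟨0, ⟨_, hmem⟩, fun h ↦ hc (congrArg Subtype.val h).symm, ?_⟩
    refine Set.eq_univ_of_forall fun ⟨x, hx⟩ ↦ ?_
    rw [← Submodule.mem_toAddSubgroup, Submodule.torsion_int] at hx
    have hx' : IsOfFinOrder x.toMul := isOfFinAddOrder_ofMul_iff.mp hx
    rcases htors x.toMul hx' with h | h
    · exact Or.inl (Subtype.ext h)
    · exact Or.inr (Subtype.ext h)
  have : Fact (Nat.Prime 2) := ⟨Nat.prime_two⟩
  let t : Submodule.torsion ℤ (Additive G) ≃+ Additive ℤˣ :=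
    addEquivOfPrimeCardEq hcard (by rw [Nat.card_eq_fintype_card]; rfl)
  let e' : Additive G ≃+ Additive ℤˣ × (Fin (Module.finrank ℤ (Additive G)) → ℤ) :=
    e.toAddEquiv.trans (t.prodCongr (AddEquiv.refl _))
  exact ⟨{ toFun x := ((e' (.ofMul x)).1.toMul, .ofAdd (e' (.ofMul x)).2)
           invFun y := (e'.symm (.ofMul y.1, y.2.toAdd)).toMul
           left_inv x := by simp
           right_inv y := by simp
           map_mul' x y := by simp }⟩

namespace NumberField

/-- A number field all of whose complex embeddings have real image is totally real. -/
theorem IsTotallyReal.of_forall_im_eq_zero {K : Type*} [Field K]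
    (h : ∀ φ : K →+* ℂ, ∀ x : K, (φ x).im = 0) : IsTotallyReal K where
  isReal v := by
    rw [← v.mk_embedding, InfinitePlace.isReal_mk_iff]
    exact RingHom.ext fun x ↦ Complex.conj_eq_iff_im.mpr (h _ x)

theorem Units.rank_add_one_eq_finrank (K : Type*) [Field K] [NumberField K] [IsTotallyReal K] :
    Units.rank K + 1 = Module.finrank ℚ K := by
  rw [IsTotallyReal.finrank, Units.rank, InfinitePlace.card_eq_nrRealPlaces_add_nrComplexPlaces,
    IsTotallyReal.nrComplexPlaces_eq_zero, add_zero, Nat.sub_add_cancel]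
  rw [← IsTotallyReal.finrank]
  exact Module.finrank_pos

/-- The units of finite order of a totally real field are `±1`. -/
theorem Units.eq_one_or_neg_one_of_isOfFinOrder {K : Type*} [Field K] [NumberField K]
    [IsTotallyReal K] {u : (𝓞 K)ˣ} (hu : IsOfFinOrder u) : u = 1 ∨ u = -1 := by
  obtain ⟨φ⟩ : Nonempty (K →+* ℂ) := inferInstance
  have hφ := IsTotallyReal.complexEmbedding_isReal φ
  let ψ : (𝓞 K) →+* ℝ := hφ.embedding.comp (algebraMap (𝓞 K) K)
  have hψ : Function.Injective ψ :=
    hφ.embedding.injective.comp RingOfIntegers.coe_injective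
  obtain ⟨n, hn, h⟩ := isOfFinOrder_iff_pow_eq_one.mp hu
  have h1 : |ψ u| ^ n = 1 := by
    rw [← abs_pow, ← map_pow, ← Units.val_pow_eq_pow_val, h]
    simp
  have h2 : |ψ u| = 1 := (pow_eq_one_iff_of_nonneg (abs_nonneg _) hn.ne').mp h1
  rcases (abs_eq zero_le_one).mp h2 with h | h
  · exact Or.inl (Units.ext (hψ (by simpa using h)))
  · exact Or.inr (Units.ext (hψ (by simpa using h)))

section Norm

variable (F L : Type*) [Field F] [Field L] [NumberField F] [NumberField L] [Algebra F L]

/-- The relative norm on unit groups has kernel of rank `rank L - rank F`. -/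
theorem Units.finrank_ker_norm_add_rank :
    Module.finrank ℤ (Additive (Units.map (RingOfIntegers.norm F : 𝓞 L →* 𝓞 F)).ker) +
      Units.rank F = Units.rank L := by
  let N : Additive (𝓞 L)ˣ →ₗ[ℤ] Additive (𝓞 F)ˣ :=
    (Units.map (RingOfIntegers.norm F : 𝓞 L →* 𝓞 F)).toAdditive.toIntLinearMap
  have hker : Module.finrank ℤ (Additive (Units.map (RingOfIntegers.norm F : 𝓞 L →* 𝓞 F)).ker) =
      Module.finrank ℤ (LinearMap.ker N) := by
    let e : Additive (Units.map (RingOfIntegers.norm F : 𝓞 L →* 𝓞 F)).ker ≃+ LinearMap.ker N :=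
      { toFun x := ⟨.ofMul x.toMul.1, x.toMul.2⟩
        invFun x := .ofMul ⟨x.1.toMul, x.2⟩
        left_inv _ := rfl
        right_inv _ := rfl
        map_add' _ _ := rfl }
    exact e.toIntLinearEquiv.finrank_eq
  have hd : Module.finrank F L ≠ 0 := Module.finrank_pos.ne'
  let P : Additive (𝓞 F)ˣ →ₗ[ℤ] Additive (𝓞 F)ˣ :=
    LinearMap.lsmul ℤ _ (Module.finrank F L : ℤ)
  have hP : Module.finrank ℤ (LinearMap.ker P) = 0 := by
    rw [Module.finrank_eq_zero_iff]
    exact fun x ↦ ⟨Module.finrank F L, by exact_mod_cast hd, Subtype.ext x.2⟩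
  have hPN : LinearMap.range P ≤ LinearMap.range N := by
    rintro _ ⟨x, rfl⟩
    refine ⟨.ofMul (Units.map (algebraMap (𝓞 F) (𝓞 L) : 𝓞 F →* 𝓞 L) x.toMul), ?_⟩
    change Additive.ofMul (Units.map _ (Units.map _ x.toMul)) = (Module.finrank F L : ℤ) • x
    rw [natCast_zsmul]
    exact congrArg Additive.ofMul (Units.ext (RingOfIntegers.norm_algebraMap (L := L) F (x.toMul : 𝓞 F)))
  have h1 := (LinearMap.ker P).finrank_quotient_add_finrank
  have h2 := (LinearMap.ker N).finrank_quotient_add_finrank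
  have h3 := Submodule.finrank_mono hPN
  have h4 := Submodule.finrank_le (LinearMap.range N)
  rw [P.quotKerEquivRange.finrank_eq, Units.finrank_eq] at h1
  rw [N.quotKerEquivRange.finrank_eq, Units.finrank_eq] at h2
  rw [Units.finrank_eq] at h4
  omega

end Norm

end NumberField


/-- Let `F ⊆ L` be totally real number fields with `[F : ℚ] = g` and `[L : F] = 2`. Then the
group of units of `𝓞_L` of relative norm 1 over `F` is isomorphic to `{±1} × ℤ^g`. -/
theorem relative_norm_one_units_structure (F L : Type*) [Field F] [Field L]
    [NumberField F] [NumberField L] [Algebra F L] (g : ℕ)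
    (hF : ∀ φ : F →+* ℂ, ∀ x : F, (φ x).im = 0)
    (hL : ∀ φ : L →+* ℂ, ∀ x : L, (φ x).im = 0)
    (hg : Module.finrank ℚ F = g) (hdeg : Module.finrank F L = 2) :
    Nonempty
      ((MonoidHom.ker ((Units.map (Algebra.norm F : L →* F)).comp
          (Units.map (algebraMap (𝓞 L) L : (𝓞 L) →* L)))) ≃*
        ℤˣ × Multiplicative (Fin g → ℤ)) := by
  have := IsTotallyReal.of_forall_im_eq_zero hF
  have := IsTotallyReal.of_forall_im_eq_zero hL
  have hker : MonoidHom.ker ((Units.map (Algebra.norm F : L →* F)).comp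
      (Units.map (algebraMap (𝓞 L) L : (𝓞 L) →* L))) =
      (Units.map (RingOfIntegers.norm F : 𝓞 L →* 𝓞 F)).ker := by
    ext u
    simp only [MonoidHom.mem_ker, Units.ext_iff, RingOfIntegers.ext_iff]
    rfl
  rw [hker]
  have hrank : Module.finrank ℤ
      (Additive (Units.map (RingOfIntegers.norm F : 𝓞 L →* 𝓞 F)).ker) = g := by
    have h1 := Units.finrank_ker_norm_add_rank F L
    have h2 := Units.rank_add_one_eq_finrank F
    have h3 := Units.rank_add_one_eq_finrank L
    have h4 := Module.finrank_mul_finrank ℚ F L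
    rw [hg, hdeg] at h4
    omega
  have : Module.Finite ℤ (Additive (Units.map (RingOfIntegers.norm F : 𝓞 L →* 𝓞 F)).ker) :=
    Module.Finite.of_injective
      (Units.map (RingOfIntegers.norm F : 𝓞 L →* 𝓞 F)).ker.subtype.toAdditive.toIntLinearMap
      Subtype.val_injective
  have hneg : (-1 : (𝓞 L)ˣ) ∈ (Units.map (RingOfIntegers.norm F : 𝓞 L →* 𝓞 F)).ker := by
    rw [MonoidHom.mem_ker, Units.ext_iff, Units.coe_map]
    have h := RingOfIntegers.norm_algebraMap (L := L) F (-1 : 𝓞 F)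
    rw [hdeg] at h
    simpa using h
  refine nonempty_mulEquiv_intUnits_prod_of_torsion ⟨-1, hneg⟩ ?_ ?_ ?_ g hrank
  · intro h
    have h' := congrArg (fun x ↦ ((x.1 : 𝓞 L) : L)) h
    norm_num at h'
  · exact Subtype.ext (by simp)
  · intro x hx
    have hx' : IsOfFinOrder (x : (𝓞 L)ˣ) := (Subgroup.subtype _).isOfFinOrder hx
    exact (Units.eq_one_or_neg_one_of_isOfFinOrder hx').imp Subtype.ext Subtype.ext
end
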